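/- Jacobian of the LU (Doolittle) decomposition: for X = ΔΥ with Δ unit lower triangular (δ_ii = 1) and Υ upper triangular m×m real matrices, the Lebesgue measure satisfies (dX) = ∏_{i=1}^m |υ_ii|^{m-i} (dΥ)(dΔ). -/

import Mathlib

open MeasureTheory Matrix

noncomputable section

instance matrixMeasureSpace {n m : ℕ} : MeasureSpace (Matrix (Fin n) (Fin m) ℝ) :=
  inferInstanceAs (MeasureSpace (Fin n → Fin m → ℝ))

/-- Index set for the strictly lower-triangular entries. -/
abbrev LowIdx (m : ℕ) := {p : Fin m × Fin m // p.2 < p.1}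

/-- Index set for the upper-triangular entries (with diagonal). -/
abbrev UpIdx (m : ℕ) := {p : Fin m × Fin m // p.1 ≤ p.2}

/-- Unit lower-triangular matrix built from its strictly lower entries. -/
def unitLowerOf {m : ℕ} (l : LowIdx m → ℝ) : Matrix (Fin m) (Fin m) ℝ :=
  Matrix.of fun i j => if h : j < i then l ⟨(i, j), h⟩ else if i = j then 1 else 0

/-- Upper-triangular matrix built from its upper entries. -/
def upperOf {m : ℕ} (u : UpIdx m → ℝ) : Matrix (Fin m) (Fin m) ℝ :=
  Matrix.of fun i j => if h : i ≤ j then u ⟨(i, j), h⟩ else 0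


namespace LUJac

lemma pi_split {ι α β : Type} [Fintype ι] [Fintype α] [Fintype β] (e : α ⊕ β ≃ ι) :
    MeasurePreserving (fun (p : (α → ℝ) × (β → ℝ)) (i : ι) => Sum.elim p.1 p.2 (e.symm i))
      volume volume := by
  have h := (volume_measurePreserving_piCongrLeft (fun _ : ι => ℝ) e).comp
    (volume_measurePreserving_sumPiEquivProdPi_symm (fun _ : α ⊕ β => ℝ))
  convert h using 1
  funext p i
  obtain ⟨x, rfl⟩ := e.surjective i
  simp only [Function.comp, Equiv.symm_apply_apply]
  erw [MeasurableEquiv.coe_piCongrLeft, Equiv.piCongrLeft_apply_apply]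
  rcases x with x | x <;> rfl

def lowFun (m : ℕ) : Fin m ⊕ LowIdx m → LowIdx (m + 1)
  | .inl i => ⟨(i.succ, 0), Fin.succ_pos i⟩
  | .inr p => ⟨(p.1.1.succ, p.1.2.succ), Fin.succ_lt_succ_iff.2 p.2⟩

lemma lowFun_bij (m : ℕ) : Function.Bijective (lowFun m) := by
  constructor
  · rintro (i | ⟨⟨i, j⟩, h⟩) (i' | ⟨⟨i', j'⟩, h'⟩) hh <;>
      simp_all [lowFun, Fin.ext_iff]
  · rintro ⟨⟨i, j⟩, h⟩
    cases i using Fin.cases with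
    | zero => exact absurd h (Fin.not_lt_zero _)
    | succ i =>
      cases j using Fin.cases with
      | zero => exact ⟨.inl i, rfl⟩
      | succ j => exact ⟨.inr ⟨(i, j), Fin.succ_lt_succ_iff.1 h⟩, rfl⟩

def upFun (m : ℕ) : Fin (m + 1) ⊕ UpIdx m → UpIdx (m + 1)
  | .inl i => ⟨(0, i), Fin.zero_le i⟩
  | .inr p => ⟨(p.1.1.succ, p.1.2.succ), Fin.succ_le_succ_iff.2 p.2⟩

lemma upFun_bij (m : ℕ) : Function.Bijective (upFun m) := by
  constructor
  · rintro (i | ⟨⟨i, j⟩, h⟩) (i' | ⟨⟨i', j'⟩, h'⟩) hh <;>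
      simp_all [upFun, Fin.ext_iff]
  · rintro ⟨⟨i, j⟩, h⟩
    cases i using Fin.cases with
    | zero => exact ⟨.inl j, rfl⟩
    | succ i =>
      cases j using Fin.cases with
      | zero => exact absurd h (not_le.2 (Fin.succ_pos i))
      | succ j => exact ⟨.inr ⟨(i, j), Fin.succ_le_succ_iff.1 h⟩, rfl⟩

def eLow (m : ℕ) : Fin m ⊕ LowIdx m ≃ LowIdx (m + 1) := Equiv.ofBijective _ (lowFun_bij m)
def eUp (m : ℕ) : Fin (m + 1) ⊕ UpIdx m ≃ UpIdx (m + 1) := Equiv.ofBijective _ (upFun_bij m)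

def lowJoin {m : ℕ} (p : (Fin m → ℝ) × (LowIdx m → ℝ)) : LowIdx (m + 1) → ℝ :=
  fun i => Sum.elim p.1 p.2 ((eLow m).symm i)
def upJoin {m : ℕ} (p : (Fin (m + 1) → ℝ) × (UpIdx m → ℝ)) : UpIdx (m + 1) → ℝ :=
  fun i => Sum.elim p.1 p.2 ((eUp m).symm i)

lemma lowJoin_mp (m : ℕ) : MeasurePreserving (lowJoin (m := m)) volume volume := pi_split _
lemma upJoin_mp (m : ℕ) : MeasurePreserving (upJoin (m := m)) volume volume := pi_split _

lemma lowJoin_zero {m : ℕ} (p : (Fin m → ℝ) × (LowIdx m → ℝ)) (i : Fin m)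
    (h : ((i.succ, 0) : Fin (m + 1) × Fin (m + 1)).2 < (i.succ, (0 : Fin (m + 1))).1) :
    lowJoin p ⟨(i.succ, 0), h⟩ = p.1 i := by
  have : (⟨(i.succ, 0), h⟩ : LowIdx (m + 1)) = eLow m (.inl i) := rfl
  simp [lowJoin, this]

lemma lowJoin_succ {m : ℕ} (p : (Fin m → ℝ) × (LowIdx m → ℝ)) (i j : Fin m) (h' : j < i)
    (h : ((i.succ, j.succ) : Fin (m + 1) × Fin (m + 1)).2 < (i.succ, j.succ).1) :
    lowJoin p ⟨(i.succ, j.succ), h⟩ = p.2 ⟨(i, j), h'⟩ := by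
  have : (⟨(i.succ, j.succ), h⟩ : LowIdx (m + 1)) = eLow m (.inr ⟨(i, j), h'⟩) := rfl
  simp [lowJoin, this]

lemma upJoin_zero {m : ℕ} (p : (Fin (m + 1) → ℝ) × (UpIdx m → ℝ)) (i : Fin (m + 1))
    (h : ((0, i) : Fin (m + 1) × Fin (m + 1)).1 ≤ ((0 : Fin (m + 1)), i).2) :
    upJoin p ⟨(0, i), h⟩ = p.1 i := by
  have : (⟨(0, i), h⟩ : UpIdx (m + 1)) = eUp m (.inl i) := rfl
  simp [upJoin, this]

lemma upJoin_succ {m : ℕ} (p : (Fin (m + 1) → ℝ) × (UpIdx m → ℝ)) (i j : Fin m) (h' : i ≤ j)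
    (h : ((i.succ, j.succ) : Fin (m + 1) × Fin (m + 1)).1 ≤ (i.succ, j.succ).2) :
    upJoin p ⟨(i.succ, j.succ), h⟩ = p.2 ⟨(i, j), h'⟩ := by
  have : (⟨(i.succ, j.succ), h⟩ : UpIdx (m + 1)) = eUp m (.inr ⟨(i, j), h'⟩) := rfl
  simp [upJoin, this]

/-- assemble a matrix from its first row, the rest of the first column, and the rest. -/
def mk {m : ℕ} (p : (Fin (m + 1) → ℝ) × ((Fin m → ℝ) × (Fin m → Fin m → ℝ))) :
    Fin (m + 1) → Fin (m + 1) → ℝ :=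
  Fin.cons p.1 (fun i => Fin.cons (p.2.1 i) (p.2.2 i))

lemma mk_mp (m : ℕ) : MeasurePreserving (mk (m := m)) volume volume := by
  have h1 := (volume_preserving_piFinSuccAbove (fun _ : Fin (m + 1) => Fin (m + 1) → ℝ) 0).symm
  have h2 : MeasurePreserving (fun (q : Fin m → ℝ × (Fin m → ℝ)) (i : Fin m) =>
      (MeasurableEquiv.piFinSuccAbove (fun _ : Fin (m + 1) => ℝ) 0).symm (q i)) volume volume :=
    volume_preserving_pi
      (fun _ => (volume_preserving_piFinSuccAbove (fun _ : Fin (m + 1) => ℝ) 0).symm)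
  have h3 := (volume_measurePreserving_arrowProdEquivProdArrow ℝ (Fin m → ℝ) (Fin m)).symm
  have h4 := h1.comp ((MeasurePreserving.id volume).prod (h2.comp h3))
  have e : mk (m := m) = (MeasurableEquiv.piFinSuccAbove
      (fun _ : Fin (m + 1) => Fin (m + 1) → ℝ) 0).symm ∘
      Prod.map id ((fun (q : Fin m → ℝ × (Fin m → ℝ)) (i : Fin m) =>
        (MeasurableEquiv.piFinSuccAbove (fun _ : Fin (m + 1) => ℝ) 0).symm (q i)) ∘
          (MeasurableEquiv.arrowProdEquivProdArrow ℝ (Fin m → ℝ) (Fin m)).symm) := by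
    funext p i j
    cases i using Fin.cases with
    | zero => rfl
    | succ i =>
      cases j using Fin.cases with
      | zero => rfl
      | succ j => rfl
  rw [e]
  exact h4

/-- The product, as a plain function. -/
def prodFn {m : ℕ} (l : LowIdx m → ℝ) (u : UpIdx m → ℝ) : Fin m → Fin m → ℝ :=
  unitLowerOf l * upperOf u

lemma prodFn_apply {m : ℕ} (l : LowIdx m → ℝ) (u : UpIdx m → ℝ) (i j : Fin m) :
    prodFn l u i j = ∑ k, unitLowerOf l i k * upperOf u k j := Matrix.mul_apply

lemma mul_eq {m : ℕ} (l : Fin m → ℝ) (l' : LowIdx m → ℝ) (r : Fin (m + 1) → ℝ)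
    (u' : UpIdx m → ℝ) :
    prodFn (lowJoin (l, l')) (upJoin (r, u')) =
      mk (r, r 0 • l, prodFn l' u' + fun i j => l i * r j.succ) := by
  have L0 : ∀ j : Fin m, unitLowerOf (lowJoin (l, l')) 0 j.succ = 0 := by
    intro j; simp [unitLowerOf, (Fin.succ_ne_zero j).symm]
  have L00 : unitLowerOf (lowJoin (l, l')) 0 0 = 1 := by simp [unitLowerOf]
  have Li0 : ∀ i : Fin m, unitLowerOf (lowJoin (l, l')) i.succ 0 = l i := by
    intro i; simp [unitLowerOf, lowJoin_zero]
  have Lij : ∀ i j : Fin m, unitLowerOf (lowJoin (l, l')) i.succ j.succ = unitLowerOf l' i j := by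
    intro i j
    by_cases h : j < i
    · simp [unitLowerOf, h, lowJoin_succ _ _ _ h]
    · simp [unitLowerOf, h]
  have U0 : ∀ j, upperOf (upJoin (r, u')) 0 j = r j := by
    intro j; simp [upperOf, upJoin_zero]
  have Ui0 : ∀ i : Fin m, upperOf (upJoin (r, u')) i.succ 0 = 0 := by
    intro i; simp [upperOf]
  have Uij : ∀ i j : Fin m, upperOf (upJoin (r, u')) i.succ j.succ = upperOf u' i j := by
    intro i j
    by_cases h : i ≤ j
    · simp [upperOf, h, upJoin_succ _ _ _ h]
    · simp [upperOf, h]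
  ext i j
  rw [prodFn_apply, Fin.sum_univ_succ]
  cases i using Fin.cases with
  | zero => simp [L0, L00, U0, mk]
  | succ i =>
    cases j using Fin.cases with
    | zero => simp [Li0, Ui0, U0, mk, mul_comm]
    | succ j =>
      simp only [Li0, Lij, U0, Uij, mk, Fin.cons_succ, Pi.add_apply, prodFn_apply]
      rw [add_comm]

lemma wt_eq {m : ℕ} (r : Fin (m + 1) → ℝ) (u' : UpIdx m → ℝ) :
    (∏ i : Fin (m + 1), |upJoin (r, u') ⟨(i, i), le_refl i⟩| ^ (m + 1 - (i.val + 1))) =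
      |r 0| ^ m * ∏ i : Fin m, |u' ⟨(i, i), le_refl i⟩| ^ (m - (i.val + 1)) := by
  rw [Fin.prod_univ_succ]
  congr 1
  · simp [upJoin_zero]
  · refine Finset.prod_congr rfl fun i _ => ?_
    rw [upJoin_succ _ _ _ (le_refl i)]
    simp

lemma scale {m : ℕ} (a : ℝ) (ha : a ≠ 0) (f : (Fin m → ℝ) → ENNReal) (hf : Measurable f) :
    ∫⁻ c, f c = ENNReal.ofReal (|a| ^ m) * ∫⁻ l, f (a • l) := by
  have h := Measure.map_addHaar_smul (volume : Measure (Fin m → ℝ)) ha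
  have h2 : ∫⁻ l, f (a • l) = ∫⁻ c, f c ∂(Measure.map (a • ·) volume) := by
    rw [lintegral_map hf (by fun_prop)]
  rw [h2, h, lintegral_smul_measure, smul_eq_mul, ← mul_assoc, ← ENNReal.ofReal_mul (by positivity)]
  have : |a| ^ m * |(a ^ Module.finrank ℝ (Fin m → ℝ))⁻¹| = 1 := by
    simp only [Module.finrank_fin_fun, abs_inv, abs_pow]
    exact mul_inv_cancel₀ (by positivity)
  rw [this]; simp

lemma ae_ne (m : ℕ) : ∀ᵐ r : Fin (m + 1) → ℝ, r 0 ≠ 0 := by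
  have h := (Measure.quasiMeasurePreserving_eval (fun _ : Fin (m + 1) => (volume : Measure ℝ)) 0)
  exact h.ae (Measure.ae_ne volume 0)

@[fun_prop]
lemma measurable_low {m : ℕ} :
    Measurable (fun l : LowIdx m → ℝ => (unitLowerOf l : Fin m → Fin m → ℝ)) := by
  refine measurable_pi_iff.2 fun i => measurable_pi_iff.2 fun j => ?_
  simp only [unitLowerOf, Matrix.of_apply]
  split_ifs <;> fun_prop

@[fun_prop]
lemma measurable_up {m : ℕ} :
    Measurable (fun l : UpIdx m → ℝ => (upperOf l : Fin m → Fin m → ℝ)) := by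
  refine measurable_pi_iff.2 fun i => measurable_pi_iff.2 fun j => ?_
  simp only [upperOf, Matrix.of_apply]
  split_ifs <;> fun_prop

lemma measurable_mul {m : ℕ} :
    Measurable (fun p : (LowIdx m → ℝ) × (UpIdx m → ℝ) => prodFn p.1 p.2) := by
  refine measurable_pi_iff.2 fun i => measurable_pi_iff.2 fun j => ?_
  have h1 := fun k => measurable_pi_iff.1 (measurable_pi_iff.1 (measurable_low (m := m)) i) k
  have h2 := fun k => measurable_pi_iff.1 (measurable_pi_iff.1 (measurable_up (m := m)) k) j
  simp_rw [prodFn_apply]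
  exact Finset.measurable_sum _ fun k _ =>
    ((h1 k).comp measurable_fst).mul ((h2 k).comp measurable_snd)

lemma tonelli {A B C D : Type} [MeasureSpace A] [MeasureSpace B] [MeasureSpace C] [MeasureSpace D]
    [SFinite (volume : Measure A)] [SFinite (volume : Measure B)]
    [SFinite (volume : Measure C)] [SFinite (volume : Measure D)]
    (H : (A × B) × (C × D) → ENNReal) (hH : Measurable H) :
    ∫⁻ q, H q = ∫⁻ c, ∫⁻ a, ∫⁻ p : B × D, H ((a, p.1), (c, p.2)) := by
  rw [Measure.volume_eq_prod, lintegral_prod _ hH.aemeasurable]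
  have hm2 : Measurable (fun q : A × B => ∫⁻ y, H (q, y)) := hH.lintegral_prod_right'
  rw [Measure.volume_eq_prod, lintegral_prod _ hm2.aemeasurable]
  have e1 : ∀ a : A, ∫⁻ b, ∫⁻ y, H ((a, b), y) = ∫⁻ c, ∫⁻ p : B × D, H ((a, p.1), (c, p.2)) := by
    intro a
    have a1 : ∀ b, ∫⁻ y, H ((a, b), y) = ∫⁻ c, ∫⁻ d, H ((a, b), (c, d)) := by
      intro b
      rw [Measure.volume_eq_prod, lintegral_prod]
      fun_prop
    simp_rw [a1]
    rw [lintegral_lintegral_swap]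
    · refine lintegral_congr fun c => ?_
      rw [Measure.volume_eq_prod, lintegral_prod]
      fun_prop
    · refine Measurable.aemeasurable ?_
      refine Measurable.lintegral_prod_right (f := fun (q : B × C) (d : D) =>
        H ((a, q.1), (q.2, d))) ?_
      simp only [Function.uncurry_def]
      fun_prop
  simp_rw [e1]
  rw [lintegral_lintegral_swap]
  refine Measurable.aemeasurable ?_
  refine Measurable.lintegral_prod_right (f := fun (q : A × C) (p : B × D) =>
    H ((q.1, p.1), (q.2, p.2))) ?_
  simp only [Function.uncurry_def]
  fun_prop

def F {m : ℕ} (g : (Fin m → Fin m → ℝ) → ENNReal) (l : LowIdx m → ℝ) (u : UpIdx m → ℝ) : ENNReal :=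
  g (prodFn l u) *
    ENNReal.ofReal (∏ i : Fin m, |u ⟨(i, i), le_refl i⟩| ^ (m - (i.val + 1)))

lemma measurable_F {m : ℕ} (g : (Fin m → Fin m → ℝ) → ENNReal) (hg : Measurable g) :
    Measurable (fun p : (LowIdx m → ℝ) × (UpIdx m → ℝ) => F g p.1 p.2) := by
  unfold F
  refine (hg.comp measurable_mul).mul ?_
  fun_prop

lemma right_side (m : ℕ) (g : (Fin (m + 1) → Fin (m + 1) → ℝ) → ENNReal) (hg : Measurable g) :
    ∫⁻ p : (LowIdx (m + 1) → ℝ) × (UpIdx (m + 1) → ℝ), F g p.1 p.2 =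
        ∫⁻ r, ∫⁻ l, ∫⁻ p : (LowIdx m → ℝ) × (UpIdx m → ℝ),
          F g (lowJoin (l, p.1)) (upJoin (r, p.2)) := by
  have hmF := measurable_F g hg
  have hP := (lowJoin_mp m).prod (upJoin_mp m)
  generalize hK : (fun p : (LowIdx (m + 1) → ℝ) × (UpIdx (m + 1) → ℝ) => F g p.1 p.2) = K at hmF
  have hK' : ∀ a b, F g a b = K (a, b) := by intro a b; rw [← hK]
  simp_rw [hK']
  have h1 := hP.lintegral_comp hmF
  have hmm := hmF.comp hP.measurable
  exact h1.symm.trans (tonelli _ hmm)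

lemma main (m : ℕ) : ∀ (g : (Fin m → Fin m → ℝ) → ENNReal), Measurable g →
    ∫⁻ X, g X = ∫⁻ p : (LowIdx m → ℝ) × (UpIdx m → ℝ), F g p.1 p.2 := by
  induction m with
  | zero =>
    intro g hg
    have : Unique ((LowIdx 0 → ℝ) × (UpIdx 0 → ℝ)) :=
      { default := (fun i => i.1.1.elim0, fun i => i.1.1.elim0)
        uniq := fun p => Prod.ext (funext fun i => i.1.1.elim0) (funext fun i => i.1.1.elim0) }
    rw [lintegral_unique, lintegral_unique, Measure.volume_eq_prod, ← Set.univ_prod_univ,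
      Measure.prod_prod]
    simp only [volume_pi, Measure.pi_univ, F, Finset.univ_eq_empty, Finset.prod_empty,
      ENNReal.ofReal_one, mul_one]
    congr 1
    exact Subsingleton.elim _ _
  | succ m ih =>
    intro g hg
    have hmF := measurable_F g hg
    have hmk := (mk_mp m).measurable
    -- left side
    have hL : ∫⁻ X, g X = ∫⁻ r, ∫⁻ c, ∫⁻ D, g (mk (r, c, D)) := by
      rw [← (mk_mp m).lintegral_comp hg]
      rw [Measure.volume_eq_prod, lintegral_prod _ (by fun_prop)]
      refine lintegral_congr fun r => ?_
      rw [Measure.volume_eq_prod, lintegral_prod _ (by fun_prop)]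
    have hR := right_side m g hg
    rw [hL, hR]
    refine lintegral_congr_ae ?_
    filter_upwards [ae_ne m] with r hr
    have hgm : Measurable fun q => g (mk q) := hg.comp hmk
    rw [scale (r 0) hr]
    swap
    · refine Measurable.lintegral_prod_right (f := fun c D => g (mk (r, c, D))) ?_
      exact hgm.comp (measurable_const.prodMk measurable_id)
    rw [← lintegral_const_mul' _ _ ENNReal.ofReal_ne_top]
    refine lintegral_congr fun l => ?_
    rw [← lintegral_add_right_eq_self (μ := (volume : Measure (Fin m → Fin m → ℝ))) _
      (fun i j => l i * r j.succ)]
    have hgm2 : Measurable fun D : Fin m → Fin m → ℝ =>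
        g (mk (r, r 0 • l, D + fun i j => l i * r j.succ)) := by
      refine hgm.comp (f := fun D : Fin m → Fin m → ℝ => (r, r 0 • l, D + fun i j => l i * r j.succ)) ?_
      fun_prop
    rw [ih _ hgm2, ← lintegral_const_mul' _ _ ENNReal.ofReal_ne_top]
    refine lintegral_congr fun p => ?_
    unfold F
    rw [mul_eq, wt_eq, ENNReal.ofReal_mul (by positivity)]
    ring

end LUJac

/-- Jacobian of the LU (Doolittle) decomposition `X = Δ Υ`, with `Δ` unit
lower triangular and `Υ` upper triangular: for every measurable `g`,
`∫ g(X) (dX) = ∫ g(ΔΥ) ∏_{i=1}^m |υ_ii|^{m-i} (dΥ)(dΔ)`,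
each side with Lebesgue measure on the corresponding independent entries. -/
theorem jacobian_lu_doolittle (m : ℕ)
    (g : Matrix (Fin m) (Fin m) ℝ → ENNReal) (hg : Measurable g) :
    (∫⁻ X : Matrix (Fin m) (Fin m) ℝ, g X) =
      ∫⁻ p : (LowIdx m → ℝ) × (UpIdx m → ℝ),
        g (unitLowerOf p.1 * upperOf p.2) *
          ENNReal.ofReal (∏ i : Fin m, |p.2 ⟨(i, i), le_refl i⟩| ^ (m - (i.val + 1))) := by
  exact LUJac.main m g hg
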